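/- Let K >= 4 be an even integer, set a = 2K-3, b = 2K-1, m = K^2 - (7/2)K + 2, and let Delta_K be the triangle with vertices (-1/a, 0), (m-K+2, 0), (m, (K-2)b/2). Then there exists a nonzero irreducible polynomial f ∈ C[x,y] that is supported in Delta_K and vanishes to order at least m at e = (1,1). -/

import Mathlib

open MvPolynomial

theorem add_le_of_forall_mem_support_mul {σ R : Type*} [LinearOrder σ] [CommRing R]
    [NoZeroDivisors R] (φ : (σ →₀ ℕ) →+ ℤ) {g h : MvPolynomial σ R} {c : ℤ}
    (hc : ∀ e ∈ (g * h).support, φ e ≤ c) {e e' : σ →₀ ℕ}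
    (he : e ∈ g.support) (he' : e' ∈ h.support) : φ e + φ e' ≤ c := by
  classical
  let D : (σ →₀ ℕ) → ℤ ×ₗ Lex (σ →₀ ℕ) := fun u => toLex (φ u, toLex u)
  have D_add (u v) : D (u + v) = D u + D v := by simp [D]; rfl
  have D_inj : Function.Injective D := fun u v huv => by
    have := congrArg (fun w => ofLex (ofLex w).2) huv
    simpa [D] using this
  have D_le {u v} (huv : D u ≤ D v) : φ u ≤ φ v := by
    rcases (Prod.Lex.toLex_le_toLex.1 huv) with h | h
    · exact h.le
    · exact h.1.le
  obtain ⟨u, hu, hu'⟩ := g.support.exists_max_image D ⟨e, he⟩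
  obtain ⟨v, hv, hv'⟩ := h.support.exists_max_image D ⟨e', he'⟩
  have key : (g * h).coeff (u + v) = g.coeff u * h.coeff v := by
    rw [coeff_mul]
    refine Finset.sum_eq_single (u, v) ?_ (by simp)
    rintro ⟨x, y⟩ hxy hne
    rw [Finset.HasAntidiagonal.mem_antidiagonal] at hxy
    by_contra h0
    have hx := hu' x (mem_support_iff.2 (left_ne_zero_of_mul h0))
    have hy := hv' y (mem_support_iff.2 (right_ne_zero_of_mul h0))
    have hD : D x + D y = D u + D v := by rw [← D_add, ← D_add]; exact congrArg D hxy
    have h1 := (add_eq_add_iff_eq_and_eq hx hy).1 hD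
    exact hne (Prod.ext (D_inj h1.1) (D_inj h1.2))
  have := hc (u + v) (by
    rw [mem_support_iff, key]
    exact mul_ne_zero (mem_support_iff.1 hu) (mem_support_iff.1 hv))
  rw [map_add] at this
  linarith [D_le (hu' e he), D_le (hv' e' he')]

noncomputable section

/-- A polynomial in two variables as a polynomial in `x` whose coefficients are polynomials
in `y`. -/
def columns : MvPolynomial (Fin 2) ℂ →ₐ[ℂ] Polynomial (Polynomial ℂ) :=
  aeval ![Polynomial.X, Polynomial.C Polynomial.X]

/-- The expansion of a polynomial in two variables in powers of `y - 1`, with coefficients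
polynomials in `x`. -/
def expansion : MvPolynomial (Fin 2) ℂ →ₐ[ℂ] Polynomial (Polynomial ℂ) :=
  aeval ![Polynomial.C Polynomial.X, Polynomial.X + 1]

/-- The exponent of the monomial `x ^ i * y ^ j`. -/
def expo (i j : ℕ) : Fin 2 →₀ ℕ := Finsupp.single 0 i + Finsupp.single 1 j

@[simp] theorem expo_zero (i j : ℕ) : expo i j 0 = i := by simp [expo]

@[simp] theorem expo_one (i j : ℕ) : expo i j 1 = j := by simp [expo]

theorem expo_eta (e : Fin 2 →₀ ℕ) : expo (e 0) (e 1) = e := by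
  ext k; fin_cases k <;> simp

theorem expo_eq_iff {i j : ℕ} {e : Fin 2 →₀ ℕ} : expo i j = e ↔ i = e 0 ∧ j = e 1 :=
  ⟨fun h => by simp [← h], fun h => by rw [h.1, h.2, expo_eta]⟩

theorem columns_monomial (e : Fin 2 →₀ ℕ) (c : ℂ) : columns (monomial e c) =
    Polynomial.C (Polynomial.C c * Polynomial.X ^ e 1) * Polynomial.X ^ e 0 := by
  simp [columns, aeval_monomial, Finsupp.prod_fintype, Polynomial.algebraMap_apply]
  ring

theorem expansion_monomial (e : Fin 2 →₀ ℕ) (c : ℂ) : expansion (monomial e c) =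
    Polynomial.C (Polynomial.C c * Polynomial.X ^ e 0) * (Polynomial.X + 1) ^ e 1 := by
  simp [expansion, aeval_monomial, Finsupp.prod_fintype, Polynomial.algebraMap_apply]
  ring

theorem coeff_coeff_columns (f : MvPolynomial (Fin 2) ℂ) (i j : ℕ) :
    ((columns f).coeff i).coeff j = f.coeff (expo i j) := by
  induction f using MvPolynomial.induction_on' with
  | monomial e c =>
    rw [columns_monomial, Polynomial.coeff_C_mul_X_pow, coeff_monomial]
    by_cases h0 : i = e 0 <;> by_cases h1 : j = e 1 <;>
      simp [h0, h1, eq_comm (a := e), expo_eq_iff]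
  | add p q hp hq => simp [hp, hq]

theorem coeff_coeff_expansion (f : MvPolynomial (Fin 2) ℂ) (i t : ℕ) :
    ((expansion f).coeff t).coeff i =
      (Polynomial.taylor 1 ((columns f).coeff i)).coeff t := by
  induction f using MvPolynomial.induction_on' with
  | monomial e c =>
    rw [columns_monomial, expansion_monomial, Polynomial.coeff_C_mul_X_pow,
      Polynomial.coeff_C_mul, Polynomial.coeff_X_add_one_pow, Polynomial.coeff_mul_natCast,
      Polynomial.coeff_C_mul_X_pow]
    split_ifs with h
    · rw [Polynomial.taylor_mul, Polynomial.taylor_C, Polynomial.taylor_X_pow,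
        Polynomial.coeff_C_mul, Polynomial.C_1, Polynomial.coeff_X_add_one_pow]
    · simp
  | add p q hp hq => simp [hp, hq]

/-- Vanishing to order at least `m` at the point `(1, 1)`, read off from the expansion in powers
of `y - 1`. -/
def VanishesToOrder (m : ℕ) (f : MvPolynomial (Fin 2) ℂ) : Prop :=
  ∀ t, (Polynomial.X - Polynomial.C 1) ^ (m - t) ∣ (expansion f).coeff t

theorem eq_sum_expansion (f : MvPolynomial (Fin 2) ℂ) :
    f = (expansion f).sum fun t p => Polynomial.aeval (X 0) p * (X 1 - 1) ^ t := by
  let ψ : Polynomial (Polynomial ℂ) →+* MvPolynomial (Fin 2) ℂ :=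
    Polynomial.eval₂RingHom (Polynomial.aeval (X 0 : MvPolynomial (Fin 2) ℂ)).toRingHom (X 1 - 1)
  have h : ψ.comp (expansion : MvPolynomial (Fin 2) ℂ →+* Polynomial (Polynomial ℂ)) =
      RingHom.id _ := by
    refine MvPolynomial.ringHom_ext (fun c => ?_) fun i => ?_
    · simp [ψ, expansion, Polynomial.algebraMap_apply, algebraMap_eq]
    · fin_cases i <;> simp [ψ, expansion]
  have h' := congrArg (fun r => r f) h
  simpa [ψ, Polynomial.eval₂_eq_sum, eq_comm] using h'

theorem VanishesToOrder.mem_pow {m : ℕ} {f : MvPolynomial (Fin 2) ℂ}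
    (hf : VanishesToOrder m f) :
    f ∈ (Ideal.span {X 0 - 1, X 1 - 1} : Ideal (MvPolynomial (Fin 2) ℂ)) ^ m := by
  rw [eq_sum_expansion f]
  refine Ideal.sum_mem _ fun t _ => ?_
  obtain ⟨q, hq⟩ := hf t
  have h0 : (X 0 - 1 : MvPolynomial (Fin 2) ℂ) ∈
      (Ideal.span {X 0 - 1, X 1 - 1} : Ideal (MvPolynomial (Fin 2) ℂ)) :=
    Ideal.subset_span (by simp)
  have h1 : (X 1 - 1 : MvPolynomial (Fin 2) ℂ) ∈
      (Ideal.span {X 0 - 1, X 1 - 1} : Ideal (MvPolynomial (Fin 2) ℂ)) :=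
    Ideal.subset_span (by simp)
  have h2 : (X 0 - 1 : MvPolynomial (Fin 2) ℂ) ^ (m - t) * (X 1 - 1) ^ t ∈
      (Ideal.span {X 0 - 1, X 1 - 1} : Ideal (MvPolynomial (Fin 2) ℂ)) ^ m :=
    Ideal.pow_le_pow_right (by omega : m ≤ m - t + t)
      ((pow_add (Ideal.span {X 0 - 1, X 1 - 1} : Ideal (MvPolynomial (Fin 2) ℂ)) (m - t) t) ▸
        Ideal.mul_mem_mul (Ideal.pow_mem_pow h0 _) (Ideal.pow_mem_pow h1 _))
  rw [hq]
  convert Ideal.mul_mem_left _ (Polynomial.aeval (X 0) q) h2 using 1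
  simp
  ring

theorem coeff_expansion_mul_zero (g h : MvPolynomial (Fin 2) ℂ) :
    (expansion (g * h)).coeff 0 = (expansion g).coeff 0 * (expansion h).coeff 0 := by
  simp [Polynomial.mul_coeff_zero]

/-- If the restrictions of `g` and `h` to `y = 1` vanish to orders exactly `p` and `q` at `x = 1`
and `g * h` vanishes to order `p + q`, then `g` vanishes to order `p`. -/
theorem VanishesToOrder.of_mul_left {p q : ℕ} {g h : MvPolynomial (Fin 2) ℂ}
    (hgh : VanishesToOrder (p + q) (g * h))
    (hh : Associated ((expansion h).coeff 0) ((Polynomial.X - Polynomial.C 1) ^ q)) :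
    VanishesToOrder p g := by
  set l : Polynomial ℂ := Polynomial.X - Polynomial.C 1 with hl
  have l_prime : Prime l := Polynomial.prime_X_sub_C 1
  have l_ne : l ≠ 0 := l_prime.ne_zero
  have hC : Prime (Polynomial.C l) := Polynomial.prime_C_iff.2 l_prime
  set G := (expansion g).comp (Polynomial.C l * Polynomial.X) with hG
  set H := (expansion h).comp (Polynomial.C l * Polynomial.X) with hH
  have h1 : Polynomial.C l ^ (p + q) ∣ H * G := by
    rw [← Polynomial.C_pow, Polynomial.C_dvd_iff_dvd_coeff]
    intro t
    rw [mul_comm, hG, hH, ← Polynomial.mul_comp, ← map_mul, Polynomial.comp_C_mul_X_coeff]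
    refine (pow_dvd_pow l (by omega : p + q ≤ (p + q - t) + t)).trans ?_
    rw [pow_add]
    exact mul_dvd_mul_right (hgh t) _
  have h2 : ¬ Polynomial.C l ^ (q + 1) ∣ H := fun hd => by
    rw [← Polynomial.C_pow, Polynomial.C_dvd_iff_dvd_coeff] at hd
    have := hd 0
    rw [hH, Polynomial.comp_C_mul_X_coeff, pow_zero, mul_one, hh.dvd_iff_dvd_right,
      pow_dvd_pow_iff l_ne l_prime.not_isUnit] at this
    omega
  have h3 : Polynomial.C l ^ p ∣ G := by
    have h4 : emultiplicity (Polynomial.C l) H ≤ q := by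
      rw [← not_lt, ← ENat.add_one_le_iff (ENat.natCast_ne_top q)]
      exact fun hle => h2 (pow_dvd_iff_le_emultiplicity.2 (by exact_mod_cast hle))
    rw [pow_dvd_iff_le_emultiplicity] at h1 ⊢
    rw [emultiplicity_mul hC, Nat.cast_add, add_comm (p : ℕ∞)] at h1
    have h5 := h1.trans (add_le_add_left h4 _)
    exact (ENat.add_le_add_iff_left (ENat.natCast_ne_top q)).1 h5
  intro t
  rw [← Polynomial.C_pow, Polynomial.C_dvd_iff_dvd_coeff] at h3
  have h4 := h3 t
  rw [hG, Polynomial.comp_C_mul_X_coeff] at h4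
  rcases le_or_gt p t with h | h
  · simp [Nat.sub_eq_zero_of_le h]
  · rw [← Nat.sub_add_cancel h.le, pow_add] at h4
    exact (mul_dvd_mul_iff_right (pow_ne_zero t l_ne)).1 h4

theorem X_pow_mul_X_sub_one_pow_dvd {P : Polynomial ℂ} {s t : ℕ} (hs : Polynomial.X ^ s ∣ P)
    (ht : (Polynomial.X - Polynomial.C 1) ^ t ∣ P) :
    Polynomial.X ^ s * (Polynomial.X - Polynomial.C 1) ^ t ∣ P :=
  IsCoprime.mul_dvd (IsCoprime.pow ⟨1, -1, by simp⟩) hs ht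

theorem monic_X_pow_mul_X_sub_one_pow (s t : ℕ) :
    (Polynomial.X ^ s * (Polynomial.X - Polynomial.C (1 : ℂ)) ^ t).Monic :=
  (Polynomial.monic_X_pow s).mul ((Polynomial.monic_X_sub_C 1).pow t)

theorem natDegree_X_pow_mul_X_sub_one_pow (s t : ℕ) :
    (Polynomial.X ^ s * (Polynomial.X - Polynomial.C (1 : ℂ)) ^ t).natDegree = s + t := by
  rw [(Polynomial.monic_X_pow s).natDegree_mul ((Polynomial.monic_X_sub_C 1).pow t),
    (Polynomial.monic_X_sub_C (1 : ℂ)).natDegree_pow, Polynomial.natDegree_X_sub_C,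
    Polynomial.natDegree_X_pow, mul_one]

theorem exists_eq_C_mul_of_dvd {P : Polynomial ℂ} {s t : ℕ} (hs : Polynomial.X ^ s ∣ P)
    (ht : (Polynomial.X - Polynomial.C 1) ^ t ∣ P) (hP : P.natDegree ≤ s + t) :
    ∃ c, P = Polynomial.C c * (Polynomial.X ^ s * (Polynomial.X - Polynomial.C 1) ^ t) := by
  obtain ⟨r, hr⟩ := X_pow_mul_X_sub_one_pow_dvd hs ht
  have hr0 : r.natDegree = 0 := by
    rcases eq_or_ne r 0 with rfl | hne
    · simp
    · rw [hr, (monic_X_pow_mul_X_sub_one_pow s t).natDegree_mul' hne,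
        natDegree_X_pow_mul_X_sub_one_pow] at hP
      omega
  refine ⟨r.coeff 0, ?_⟩
  rw [← Polynomial.eq_C_of_natDegree_eq_zero hr0, mul_comm, hr]

theorem eq_zero_of_dvd_of_coeff_eq_zero {P : Polynomial ℂ} {s t : ℕ}
    (hs : Polynomial.X ^ s ∣ P) (ht : (Polynomial.X - Polynomial.C 1) ^ t ∣ P)
    (hP : ∀ j, s + t ≤ j → P.coeff j = 0) : P = 0 := by
  refine Polynomial.eq_zero_of_dvd_of_degree_lt (X_pow_mul_X_sub_one_pow_dvd hs ht) ?_
  rw [Polynomial.degree_eq_natDegree (monic_X_pow_mul_X_sub_one_pow s t).ne_zero,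
    natDegree_X_pow_mul_X_sub_one_pow]
  exact (Polynomial.degree_lt_iff_coeff_zero _ _).2 hP

theorem coeff_X_sub_one_pow (n : ℕ) :
    ((Polynomial.X - Polynomial.C (1 : ℂ)) ^ (n + 1)).coeff (n + 1) = 1 ∧
      ((Polynomial.X - Polynomial.C (1 : ℂ)) ^ (n + 1)).coeff n = -((n : ℂ) + 1) := by
  have h : Polynomial.X - Polynomial.C (1 : ℂ) = Polynomial.X + Polynomial.C (-1) := by
    rw [Polynomial.C_neg, sub_eq_add_neg]
  rw [h, Polynomial.coeff_X_add_C_pow, Polynomial.coeff_X_add_C_pow]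
  simp

theorem coeff_columns_eq_zero {f : MvPolynomial (Fin 2) ℂ} {i j : ℕ} {P : (Fin 2 →₀ ℕ) → Prop}
    (hf : ∀ e ∈ f.support, P e) (h : ¬ P (expo i j)) : ((columns f).coeff i).coeff j = 0 := by
  rw [coeff_coeff_columns]
  by_contra h0
  exact h (hf _ (mem_support_iff.2 h0))

/-- The triangle with a left edge of slope `a / (a - 2)` through the origin and the vertex `(p, h)`
and a right edge of slope `(a + 2) / 2`, where `a = 4 k + 5`, does not support a polynomial
that vanishes to order `p` and involves the monomial of the vertex. -/
theorem not_vanishesToOrder_of_support {k p h : ℕ} {g : MvPolynomial (Fin 2) ℂ} (hp : 0 < p)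
    (hph : (4 * k + 5) * p = (4 * k + 3) * h)
    (hdeg : ∀ e ∈ g.support, e 0 ≤ p)
    (hleft : ∀ e ∈ g.support, (4 * k + 3) * e 1 ≤ (4 * k + 5) * e 0)
    (hright : ∀ e ∈ g.support, (4 * k + 7) * e 0 + 2 * h ≤ (4 * k + 7) * p + 2 * e 1)
    (htop : g.coeff (expo p h) ≠ 0) : ¬ VanishesToOrder p g := by
  intro hord
  set γ := g.coeff (expo p h) with hγ
  have hpk : 4 * k + 3 ≤ p := by
    refine Nat.le_of_dvd hp (Nat.Coprime.dvd_of_dvd_mul_left ?_ ⟨h, hph⟩)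
    rw [show 4 * k + 5 = 2 + (4 * k + 3) by ring, Nat.coprime_add_self_right,
      Nat.coprime_two_right]
    exact ⟨2 * k + 1, by ring⟩
  have hhp : p < h := by nlinarith
  have hhk : 4 * k + 5 ≤ h := by nlinarith
  have col_top : (columns g).coeff p = Polynomial.C γ * Polynomial.X ^ h := by
    ext j
    rw [Polynomial.coeff_C_mul_X_pow]
    split_ifs with hj
    · rw [coeff_coeff_columns, hj]
    · by_contra h0
      have hmem : expo p j ∈ g.support := by rwa [mem_support_iff, ← coeff_coeff_columns]
      have h1 := hleft _ hmem
      have h2 := hright _ hmem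
      simp only [expo_zero, expo_one] at h1 h2
      rw [hph] at h1
      have := Nat.le_of_mul_le_mul_left h1 (by omega)
      omega
  have col_sub : ∀ t ≤ 2 * k + 2, (Polynomial.taylor 1 ((columns g).coeff (p - 1))).coeff t =
      -((p : ℂ) - t) * (γ * h.choose t) := by
    intro t ht
    have hX : Polynomial.X ^ t ∣ (expansion g).coeff t := by
      rw [Polynomial.X_pow_dvd_iff]
      intro i hi
      rw [coeff_coeff_expansion]
      refine Polynomial.coeff_eq_zero_of_natDegree_lt ?_
      rw [Polynomial.natDegree_taylor]
      refine lt_of_le_of_lt (Polynomial.natDegree_le_iff_coeff_eq_zero.2 fun j hj => ?_) hi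
      refine coeff_columns_eq_zero hleft ?_
      simp only [expo_zero, expo_one, not_le]
      nlinarith
    have hE : ((expansion g).coeff t).natDegree ≤ t + (p - t) := by
      refine Polynomial.natDegree_le_iff_coeff_eq_zero.2 fun i hi => ?_
      have h0 : (columns g).coeff i = 0 := by
        ext j
        refine coeff_columns_eq_zero hdeg ?_
        simp only [expo_zero, not_le]
        omega
      rw [coeff_coeff_expansion, h0]
      simp
    obtain ⟨c, hc⟩ := exists_eq_C_mul_of_dvd hX (hord t) hE
    obtain ⟨s, hs⟩ : ∃ s, p = t + (s + 1) := ⟨p - t - 1, by omega⟩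
    have h1 := coeff_coeff_expansion g p t
    have h2 := coeff_coeff_expansion g (p - 1) t
    rw [col_top, Polynomial.taylor_mul, Polynomial.taylor_C, Polynomial.taylor_X_pow,
      Polynomial.coeff_C_mul, Polynomial.C_1, Polynomial.coeff_X_add_one_pow] at h1
    rw [← h2, ← h1, hc, show p - t = s + 1 by omega, show p - 1 = s + t by omega,
      show p = (s + 1) + t by omega, Polynomial.coeff_C_mul, Polynomial.coeff_C_mul,
      Polynomial.coeff_X_pow_mul, Polynomial.coeff_X_pow_mul, (coeff_X_sub_one_pow s).1,
      (coeff_X_sub_one_pow s).2]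
    push_cast
    ring
  obtain ⟨c, hc⟩ : ∃ c, h = c + (2 * k + 3) := ⟨h - (2 * k + 3), by omega⟩
  obtain ⟨w, hw⟩ : Polynomial.X ^ c ∣ (columns g).coeff (p - 1) := by
    rw [Polynomial.X_pow_dvd_iff]
    intro j hj
    refine coeff_columns_eq_zero hright ?_
    simp only [expo_zero, expo_one, not_le]
    obtain ⟨p', rfl⟩ : ∃ p', p = p' + 1 := ⟨p - 1, by omega⟩
    simp only [Nat.add_sub_cancel]
    nlinarith
  have hwdeg : ∀ j, 2 * k + 2 ≤ j → w.coeff j = 0 := by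
    intro j hj
    have h0 : ((columns g).coeff (p - 1)).coeff (j + c) = 0 := by
      refine coeff_columns_eq_zero hleft ?_
      simp only [expo_zero, expo_one, not_le]
      obtain ⟨p', rfl⟩ : ∃ p', p = p' + 1 := ⟨p - 1, by omega⟩
      simp only [Nat.add_sub_cancel]
      nlinarith
    rwa [hw, Polynomial.coeff_X_pow_mul] at h0
  set V : Polynomial ℂ := w + Polynomial.C γ * (Polynomial.C ((p : ℂ) - h) *
    Polynomial.X ^ (2 * k + 3) + Polynomial.C (h : ℂ) * Polynomial.X ^ (2 * k + 2)) with hV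
  have hdvd : (Polynomial.X - Polynomial.C 1) ^ (2 * k + 3) ∣ Polynomial.X ^ c * V := by
    have hQ : Polynomial.X ^ c * V = (columns g).coeff (p - 1) + Polynomial.C γ *
        (Polynomial.C (p : ℂ) * Polynomial.X ^ (c + (2 * k + 2) + 1) - Polynomial.C (h : ℂ) *
          ((Polynomial.X - Polynomial.C 1) * Polynomial.X ^ (c + (2 * k + 2)))) := by
      rw [hw, hV]
      simp only [map_sub, map_one]
      ring
    rw [Polynomial.X_sub_C_pow_dvd_iff, ← Polynomial.taylor_apply, Polynomial.X_pow_dvd_iff, hQ]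
    intro t ht
    have hX : Polynomial.taylor (1 : ℂ) (Polynomial.X - Polynomial.C 1) = Polynomial.X := by
      simp
    simp only [map_add, map_sub (Polynomial.taylor (1 : ℂ)) (_ * _), Polynomial.taylor_mul,
      Polynomial.taylor_C, Polynomial.taylor_X_pow, hX, Polynomial.coeff_add,
      Polynomial.coeff_sub, Polynomial.coeff_C_mul]
    rw [col_sub t (by omega), Polynomial.C_1, Polynomial.coeff_X_add_one_pow, hc]
    cases t with
    | zero =>
      simp [Polynomial.mul_coeff_zero]
      ring
    | succ t =>
      rw [Polynomial.coeff_X_mul, Polynomial.coeff_X_add_one_pow]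
      have := congrArg (Nat.cast (R := ℂ)) (Nat.add_one_mul_choose_eq (c + (2 * k + 2)) t)
      rw [show c + (2 * k + 3) = c + (2 * k + 2) + 1 by ring]
      push_cast at this ⊢
      linear_combination (-γ) * this
  have hcop : IsCoprime (Polynomial.X - Polynomial.C (1 : ℂ)) Polynomial.X := ⟨-1, 1, by simp⟩
  have hVdvd := (hcop.pow (m := 2 * k + 3) (n := c)).dvd_of_dvd_mul_left hdvd
  have hVdeg : V.natDegree ≤ 0 + (2 * k + 3) := by
    refine Polynomial.natDegree_le_iff_coeff_eq_zero.2 fun j hj => ?_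
    rw [hV, Polynomial.coeff_add, hwdeg j (by omega)]
    simp only [Polynomial.coeff_C_mul, Polynomial.coeff_add, Polynomial.coeff_X_pow,
      if_neg (show j ≠ 2 * k + 3 by omega), if_neg (show j ≠ 2 * k + 2 by omega)]
    ring
  obtain ⟨ρ, hρ⟩ := exists_eq_C_mul_of_dvd (by simp) hVdvd hVdeg
  rw [pow_zero, one_mul] at hρ
  obtain ⟨b1, b2⟩ := coeff_X_sub_one_pow (2 * k + 2)
  have e1 := congrArg (fun r => r.coeff (2 * k + 3)) hρ
  have e2 := congrArg (fun r => r.coeff (2 * k + 2)) hρ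
  simp only [hV, Polynomial.coeff_add, Polynomial.coeff_C_mul, Polynomial.coeff_X_pow,
    hwdeg _ le_rfl, hwdeg _ (Nat.le_succ _), b1, b2] at e1 e2
  simp at e1 e2
  have hγ0 : γ * (h - (2 * k + 3) * ((h : ℂ) - p)) = 0 := by
    linear_combination e2 + (2 * k + 3) * e1
  have hz : (h : ℂ) - (2 * k + 3) * ((h : ℂ) - p) = 0 := (mul_eq_zero.1 hγ0).resolve_left htop
  have hz' : (h : ℤ) - (2 * k + 3) * ((h : ℤ) - p) = 0 := by exact_mod_cast hz
  zify at hph hhp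
  nlinarith

/-- The order of vanishing `K ^ 2 - 7 K / 2 + 2`, where `K = 2 k + 4`. -/
def order (k : ℕ) : ℕ := 4 * k ^ 2 + 9 * k + 4

/-- The lattice points of the triangle with vertices `(-1 / (4 k + 5), 0)`,
`(4 k ^ 2 + 7 k + 2, 0)` and `(order k, (k + 1) (4 k + 7))`. -/
def InTriangle (k i j : ℕ) : Prop :=
  (4 * k + 3) * j ≤ (4 * k + 5) * i + 1 ∧
    (4 * k + 7) * i ≤ 2 * j + (4 * k + 7) * (4 * k ^ 2 + 7 * k + 2)

theorem InTriangle.le_order {k i j : ℕ} (h : InTriangle k i j) : i ≤ order k := by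
  obtain ⟨h1, h2⟩ := h
  by_contra! hi
  rw [order] at hi
  nlinarith

theorem eq_zero_of_expansion_eq_zero {f : MvPolynomial (Fin 2) ℂ} (h : expansion f = 0) :
    f = 0 := by
  rw [eq_sum_expansion f, h, Polynomial.sum_zero_index]

theorem column_eq_zero_of_window {f : MvPolynomial (Fin 2) ℂ} {c i : ℕ} (lo : ℕ)
    (hc : ∀ t < c, (expansion f).coeff t = 0)
    (hlo : ∀ j, f.coeff (expo i j) ≠ 0 → lo ≤ j ∧ j < lo + c) : (columns f).coeff i = 0 := by
  refine eq_zero_of_dvd_of_coeff_eq_zero (s := lo) (t := c) ?_ ?_ fun j hj => ?_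
  · rw [Polynomial.X_pow_dvd_iff]
    intro j hj
    rw [coeff_coeff_columns]
    by_contra h0
    exact absurd (hlo j h0).1 (by omega)
  · rw [Polynomial.X_sub_C_pow_dvd_iff, ← Polynomial.taylor_apply, Polynomial.X_pow_dvd_iff]
    intro t ht
    rw [← coeff_coeff_expansion, hc t ht, Polynomial.coeff_zero]
  · rw [coeff_coeff_columns]
    by_contra h0
    exact absurd (hlo j h0).2 (by omega)

theorem expansion_coeff_zero_ne_zero {k : ℕ} {f : MvPolynomial (Fin 2) ℂ} (hf : f ≠ 0)
    (hsupp : ∀ e ∈ f.support, InTriangle k (e 0) (e 1)) (hord : VanishesToOrder (order k) f) :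
    (expansion f).coeff 0 ≠ 0 := by
  classical
  have hex : ∃ c, (expansion f).coeff c ≠ 0 := by
    by_contra! h
    exact hf (eq_zero_of_expansion_eq_zero (Polynomial.ext (by simpa using h)))
  obtain ⟨c, hc, hmin⟩ : ∃ c, (expansion f).coeff c ≠ 0 ∧ ∀ t < c, (expansion f).coeff t = 0 :=
    ⟨Nat.find hex, Nat.find_spec hex, fun t ht => not_not.1 (Nat.find_min hex ht)⟩
  rcases Nat.eq_zero_or_pos c with rfl | hc0
  · exact hc
  refine absurd ?_ hc
  have htri : ∀ i j, f.coeff (expo i j) ≠ 0 → InTriangle k i j := fun i j h => by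
    simpa using hsupp _ (mem_support_iff.2 h)
  set v := (2 * c + 1) / (4 * k + 5) + 1 with hv
  have hv1 : 2 * c + 2 ≤ (4 * k + 5) * v := by
    have := Nat.lt_mul_div_succ (2 * c + 1) (by omega : 0 < 4 * k + 5)
    rw [hv]; omega
  have hv2 : ∀ u < v, (4 * k + 5) * u ≤ 2 * c + 1 := fun u hu => by
    have h1 : u ≤ (2 * c + 1) / (4 * k + 5) := by omega
    rw [Nat.le_div_iff_mul_le (by omega)] at h1
    linarith
  have hcol : ∀ i, (columns f).coeff i = 0 → ((expansion f).coeff c).coeff i = 0 := fun i h => by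
    rw [coeff_coeff_expansion, h]; simp
  refine eq_zero_of_dvd_of_coeff_eq_zero (s := c + 1 - v) (t := order k - c) ?_ (hord c)
    fun i hi => hcol i ?_
  · rw [Polynomial.X_pow_dvd_iff]
    intro i hi
    refine hcol i (column_eq_zero_of_window 0 hmin fun j hj => ⟨Nat.zero_le _, ?_⟩)
    have h1 := (htri i j hj).1
    obtain ⟨d, hd⟩ : ∃ d, c = i + v + d := ⟨c - (i + v), by omega⟩
    by_contra! hlt
    rw [zero_add] at hlt
    clear_value v
    subst hd
    nlinarith
  · by_cases him : i ≤ order k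
    swap
    · ext j
      rw [coeff_coeff_columns, Polynomial.coeff_zero]
      by_contra h0
      exact him (htri i j h0).le_order
    obtain ⟨u, hu⟩ := Nat.exists_eq_add_of_le him
    have hau := hv2 u (by omega)
    have hu' : order k = i + u := hu
    rw [order] at hu'
    rcases Nat.eq_zero_or_pos u with rfl | hu0
    · refine column_eq_zero_of_window ((k + 1) * (4 * k + 7)) hmin fun j hj => ?_
      obtain ⟨h1, h2⟩ := htri i j hj
      have hi' : i = 4 * k ^ 2 + 9 * k + 4 := by omega
      rw [hi'] at h1 h2
      constructor
      · nlinarith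
      · have : j < (k + 1) * (4 * k + 7) + 1 := by
          by_contra! hlt
          nlinarith
        omega
    · refine column_eq_zero_of_window ((k + 1) * (4 * k + 7) - u - c) hmin fun j hj => ?_
      obtain ⟨h1, h2⟩ := htri i j hj
      zify at h1 h2 hu' hau hu0
      have hi' : (i : ℤ) = 4 * k ^ 2 + 9 * k + 4 - u := by linarith
      rw [hi'] at h1 h2
      have h3 : (j : ℤ) < (k + 1) * (4 * k + 7) - u := by
        by_contra! hlt
        nlinarith
      have h4 : ((k : ℤ) + 1) * (4 * k + 7) - u - c ≤ j := by
        have : 2 * (((k : ℤ) + 1) * (4 * k + 7) - u - c) ≤ 2 * j + 1 := by nlinarith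
        omega
      generalize hA : (k + 1) * (4 * k + 7) = A
      zify at hA
      rw [hA] at h3 h4
      omega

theorem exists_mem_support_of_expansion_coeff {f : MvPolynomial (Fin 2) ℂ} {i : ℕ}
    (h : ((expansion f).coeff 0).coeff i ≠ 0) : ∃ j, expo i j ∈ f.support := by
  by_contra! hj
  refine h ?_
  have h0 : (columns f).coeff i = 0 := by
    ext j
    rw [coeff_coeff_columns, Polynomial.coeff_zero]
    simpa using hj j
  rw [coeff_coeff_expansion, h0]
  simp

theorem exists_mem_support_of_associated {f : MvPolynomial (Fin 2) ℂ} {p : ℕ}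
    (h : Associated ((expansion f).coeff 0) ((Polynomial.X - Polynomial.C 1) ^ p)) :
    (∃ j, expo 0 j ∈ f.support) ∧ ∃ j, expo p j ∈ f.support := by
  obtain ⟨u, hu⟩ := h.symm
  obtain ⟨c, hc, hcu⟩ := Polynomial.isUnit_iff.1 u.isUnit
  have hc0 := hc.ne_zero
  constructor <;> refine exists_mem_support_of_expansion_coeff ?_
  · rw [← hu, ← hcu, Polynomial.coeff_zero_eq_eval_zero]
    simpa using hc0
  · have hm := (Polynomial.monic_X_sub_C (1 : ℂ)).pow p
    have hd := natDegree_X_pow_mul_X_sub_one_pow 0 p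
    rw [pow_zero, one_mul, zero_add] at hd
    rw [← hu, ← hcu, Polynomial.coeff_mul_C]
    nth_rewrite 2 [← hd]
    rw [hm.coeff_natDegree, one_mul]
    exact hc0

/-- The linear form `e ↦ α * e 0 + β * e 1`. -/
def linearForm (α β : ℤ) : (Fin 2 →₀ ℕ) →+ ℤ where
  toFun e := α * e 0 + β * e 1
  map_zero' := by simp
  map_add' e e' := by
    simp only [Finsupp.add_apply]
    push_cast
    ring

theorem InTriangle.of_mul {k : ℕ} {g h : MvPolynomial (Fin 2) ℂ}
    (hsupp : ∀ e ∈ (g * h).support, InTriangle k (e 0) (e 1)) {e e' : Fin 2 →₀ ℕ}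
    (he : e ∈ g.support) (he' : e' ∈ h.support) : InTriangle k (e 0 + e' 0) (e 1 + e' 1) := by
  have h1 := add_le_of_forall_mem_support_mul (linearForm (-(4 * k + 5)) (4 * k + 3)) (c := 1)
    (fun u hu => by
      have := (hsupp u hu).1
      zify at this
      simp only [linearForm, AddMonoidHom.coe_mk, ZeroHom.coe_mk]
      linarith) he he'
  have h2 := add_le_of_forall_mem_support_mul (linearForm (4 * k + 7) (-2))
    (c := (4 * k + 7) * (4 * k ^ 2 + 7 * k + 2))
    (fun u hu => by
      have := (hsupp u hu).2
      zify at this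
      simp only [linearForm, AddMonoidHom.coe_mk, ZeroHom.coe_mk]
      linarith) he he'
  simp only [linearForm, AddMonoidHom.coe_mk, ZeroHom.coe_mk] at h1 h2
  constructor <;> zify <;> linarith

theorem isUnit_of_mul_of_vertex {k p q h₁ h₂ : ℕ} {g h : MvPolynomial (Fin 2) ℂ}
    (hsupp : ∀ e ∈ (g * h).support, InTriangle k (e 0) (e 1)) (hpq : p + q = order k)
    (hord : VanishesToOrder (order k) (g * h))
    (hg : Associated ((expansion g).coeff 0) ((Polynomial.X - Polynomial.C 1) ^ p))
    (hh : Associated ((expansion h).coeff 0) ((Polynomial.X - Polynomial.C 1) ^ q))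
    (hg₁ : expo p h₁ ∈ g.support) (hh₂ : expo q h₂ ∈ h.support)
    (hl : (4 * k + 3) * h₁ ≤ (4 * k + 5) * p) : IsUnit g := by
  obtain ⟨⟨y, hy⟩, -⟩ := exists_mem_support_of_associated hg
  have top := InTriangle.of_mul hsupp hg₁ hh₂
  simp only [expo_zero, expo_one, hpq] at top
  have hH : h₁ + h₂ = (k + 1) * (4 * k + 7) := by
    obtain ⟨t1, t2⟩ := top
    rw [order] at t1 t2
    apply le_antisymm
    · by_contra! hlt
      nlinarith
    · nlinarith
  have hadd := fun e (he : e ∈ g.support) => InTriangle.of_mul hsupp he hh₂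
  simp only [expo_zero, expo_one] at hadd
  have hdeg : ∀ e ∈ g.support, e 0 ≤ p := fun e he => by
    have := (hadd e he).le_order
    omega
  have hpq' := hpq
  rw [order] at hpq'
  have hleft' : ∀ e ∈ g.support,
      (4 * k + 3) * e 1 + (4 * k + 5) * p ≤ (4 * k + 5) * e 0 + (4 * k + 3) * h₁ :=
    fun e he => by
      have := (hadd e he).1
      nlinarith
  have hph : (4 * k + 5) * p = (4 * k + 3) * h₁ := by
    have := hleft' _ hy
    simp only [expo_zero, expo_one] at this
    apply le_antisymm _ hl
    nlinarith
  have hleft : ∀ e ∈ g.support, (4 * k + 3) * e 1 ≤ (4 * k + 5) * e 0 := fun e he => by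
    have := hleft' e he
    omega
  have hright : ∀ e ∈ g.support, (4 * k + 7) * e 0 + 2 * h₁ ≤ (4 * k + 7) * p + 2 * e 1 :=
    fun e he => by
      have := (hadd e he).2
      nlinarith
  rcases Nat.eq_zero_or_pos p with rfl | hp
  · have hC : g = C (g.coeff 0) := by
      ext e
      rw [coeff_C]
      split_ifs with he
      · rw [he]
      · by_contra h0
        have hmem := mem_support_iff.2 h0
        have h1 := hdeg e hmem
        have h2 := hleft e hmem
        have h3 : e 0 = 0 := by omega
        rw [h3, mul_zero] at h2
        refine he (Eq.symm ?_)
        rw [← expo_eta e, h3, show e 1 = 0 by nlinarith]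
        simp [expo]
    have hg0 : g.coeff 0 ≠ 0 := fun h0 => by
      rw [h0, C_0] at hC
      simp [hC] at hy
    rw [hC]
    exact (isUnit_iff_ne_zero.2 hg0).map C
  · refine absurd ?_ (not_vanishesToOrder_of_support hp hph hdeg hleft hright
      (mem_support_iff.1 hg₁))
    exact VanishesToOrder.of_mul_left (hpq ▸ hord) hh

theorem irreducible_of_vanishesToOrder {k : ℕ} {f : MvPolynomial (Fin 2) ℂ} (hf : f ≠ 0)
    (hsupp : ∀ e ∈ f.support, InTriangle k (e 0) (e 1)) (hord : VanishesToOrder (order k) f) :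
    Irreducible f := by
  have hE := expansion_coeff_zero_ne_zero hf hsupp hord
  have l_prime : Prime (Polynomial.X - Polynomial.C (1 : ℂ)) := Polynomial.prime_X_sub_C 1
  have hassoc : Associated ((expansion f).coeff 0)
      ((Polynomial.X - Polynomial.C 1) ^ order k) := by
    obtain ⟨c, hc⟩ := exists_eq_C_mul_of_dvd (P := (expansion f).coeff 0) (s := 0)
      (t := order k) (by simp) (hord 0) (Polynomial.natDegree_le_iff_coeff_eq_zero.2
        fun i hi => by
          by_contra h0
          obtain ⟨j, hj⟩ := exists_mem_support_of_expansion_coeff h0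
          have := (hsupp _ hj).le_order
          simp only [expo_zero] at this
          omega)
    rw [pow_zero, one_mul] at hc
    have hc0 : c ≠ 0 := fun h0 => hE (by rw [hc, h0]; simp)
    rw [hc]
    exact associated_unit_mul_left _ _ (Polynomial.isUnit_C.2 (isUnit_iff_ne_zero.2 hc0))
  refine ⟨fun hunit => ?_, fun g h hgh => ?_⟩
  · have h1 : IsUnit ((expansion f).coeff 0) :=
      (hunit.map expansion).map (Polynomial.constantCoeff (R := Polynomial ℂ))
    rw [hassoc.isUnit_iff, isUnit_pow_iff (by simp [order])] at h1
    exact l_prime.not_isUnit h1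
  · subst hgh
    rw [coeff_expansion_mul_zero] at hassoc
    obtain ⟨p, -, hp⟩ := (dvd_prime_pow l_prime _).1 ((dvd_mul_right _ _).trans hassoc.dvd)
    obtain ⟨q, -, hq⟩ := (dvd_prime_pow l_prime _).1 ((dvd_mul_left _ _).trans hassoc.dvd)
    have hpq : p + q = order k := by
      have h1 := (hp.mul_mul hq).symm.trans hassoc
      rw [← pow_add] at h1
      have h2 := Polynomial.natDegree_eq_of_degree_eq (Polynomial.degree_eq_degree_of_associated h1)
      rwa [Polynomial.natDegree_pow, Polynomial.natDegree_pow, Polynomial.natDegree_X_sub_C,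
        mul_one, mul_one] at h2
    obtain ⟨-, h₁, hg₁⟩ := exists_mem_support_of_associated hp
    obtain ⟨-, h₂, hh₂⟩ := exists_mem_support_of_associated hq
    have top := (InTriangle.of_mul hsupp hg₁ hh₂).1
    simp only [expo_zero, expo_one] at top
    rcases le_or_gt ((4 * k + 3) * h₁) ((4 * k + 5) * p) with hl | hl
    · exact Or.inl (isUnit_of_mul_of_vertex hsupp hpq hord hp hq hg₁ hh₂ hl)
    · refine Or.inr (isUnit_of_mul_of_vertex (g := h) (h := g) (by rwa [mul_comm])
        (by rwa [add_comm]) (by rwa [mul_comm]) hq hp hh₂ hg₁ ?_)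
      rw [mul_add, mul_add] at top
      omega

theorem exists_vanishesToOrder {s : Finset (Fin 2 →₀ ℕ)} {m : ℕ}
    (h : m * (m + 1) < 2 * s.card) :
    ∃ f : MvPolynomial (Fin 2) ℂ, f ≠ 0 ∧ f.support ⊆ s ∧ VanishesToOrder m f := by
  classical
  let T : Finset (Σ _ : ℕ, ℕ) := (Finset.range m).sigma fun t => Finset.range (m - t)
  have hT : 2 * T.card = m * (m + 1) := by
    have h1 : T.card = ∑ t ∈ Finset.range m, (m - t) := by simp [T]
    have h2 : ∀ n : ℕ, 2 * ∑ t ∈ Finset.range n, (n - t) = n * (n + 1) := fun n => by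
      induction n with
      | zero => simp
      | succ n ih =>
        rw [Finset.sum_range_succ']
        simp only [Nat.add_sub_add_right]
        rw [mul_add, ih]
        simp
        ring
    rw [h1, h2]
  let L : (s → ℂ) →ₗ[ℂ] (T → ℂ) :=
    { toFun c p := (Polynomial.taylor 1
        ((expansion (∑ e : s, monomial (e : Fin 2 →₀ ℕ) (c e))).coeff p.1.1)).coeff p.1.2
      map_add' c d := by
        ext p
        simp [Finset.sum_add_distrib]
      map_smul' r c := by
        ext p
        simp only [Pi.smul_apply, smul_eq_mul, ← C_mul_monomial, ← smul_eq_C_mul,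
          ← Finset.smul_sum, map_smul, Polynomial.coeff_smul, RingHom.id_apply] }
  have hL : LinearMap.ker L ≠ ⊥ := LinearMap.ker_ne_bot_of_finrank_lt (by simp; omega)
  obtain ⟨c, hc, hc0⟩ := (Submodule.ne_bot_iff _).1 hL
  set f : MvPolynomial (Fin 2) ℂ := ∑ e : s, monomial (e : Fin 2 →₀ ℕ) (c e) with hf
  have hcoeff : ∀ e : s, f.coeff e = c e := fun e => by
    simp [hf, coeff_sum, coeff_monomial]
  refine ⟨f, fun h0 => hc0 (funext fun e => ?_), fun e he => ?_, fun t => ?_⟩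
  · rw [← hcoeff, h0, coeff_zero, Pi.zero_apply]
  · by_contra hes
    refine mem_support_iff.1 he ?_
    rw [hf, coeff_sum]
    refine Finset.sum_eq_zero fun e' _ => ?_
    rw [coeff_monomial, if_neg]
    rintro rfl
    exact hes e'.2
  · rw [Polynomial.X_sub_C_pow_dvd_iff, ← Polynomial.taylor_apply, Polynomial.X_pow_dvd_iff]
    intro r hr
    exact congrFun (LinearMap.mem_ker.1 hc) ⟨⟨t, r⟩, by simp [T]; omega⟩

theorem le_sum_range_mul {f g : ℕ → ℕ} {q n : ℕ}
    (h : ∀ s < n, g s ≤ ∑ r ∈ Finset.range q, f (q * s + r)) :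
    ∑ s ∈ Finset.range n, g s ≤ ∑ i ∈ Finset.range (q * n), f i := by
  induction n with
  | zero => simp
  | succ n ih =>
    rw [Finset.sum_range_succ, mul_add_one, Finset.sum_range_add]
    exact add_le_add (ih fun s hs => h s (by omega)) (h n (by omega))

/-- The points of the `i`-th column of the triangle `InTriangle k`. -/
def column (k i : ℕ) : Finset ℕ :=
  open Classical in {j ∈ Finset.range ((k + 1) * (4 * k + 7) + 1) | InTriangle k i j}

theorem le_card_column {k i lo n : ℕ}
    (h : ∀ j, lo ≤ j → j < lo + n → j ≤ (k + 1) * (4 * k + 7) ∧ InTriangle k i j) :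
    n ≤ (column k i).card := by
  have : Finset.Ico lo (lo + n) ⊆ column k i := fun j hj => by
    rw [Finset.mem_Ico] at hj
    have := h j hj.1 hj.2
    simp only [column, Finset.mem_filter, Finset.mem_range]
    exact ⟨by omega, this.2⟩
  simpa using Finset.card_le_card this

theorem le_card_column_left {k s r : ℕ} (hs : s ≤ k) (hr : r < 4 * k + 3) :
    (4 * k + 5) * s + r + 1 + (if 2 * k + 1 ≤ r then 1 else 0) ≤
      (column k ((4 * k + 3) * s + r)).card := by
  refine le_card_column (lo := 0) fun j _ hj => ?_
  obtain ⟨d, rfl⟩ := Nat.exists_eq_add_of_le hs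
  refine ⟨?_, ?_, ?_⟩ <;> split_ifs at hj <;> nlinarith

theorem le_card_column_right {k u n : ℕ} (hu0 : 0 < u) (hu : u ≤ 2 * k + 1)
    (hn : 2 * n ≤ (4 * k + 5) * u) : n ≤ (column k (order k - u)).card := by
  obtain ⟨i, hi⟩ : ∃ i, order k = i + u := ⟨order k - u,
    (Nat.sub_add_cancel (by rw [order]; nlinarith)).symm⟩
  obtain ⟨lo, hlo⟩ : ∃ lo, (k + 1) * (4 * k + 7) = lo + (u + n) :=
    ⟨(k + 1) * (4 * k + 7) - (u + n), by
      rw [Nat.sub_add_cancel]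
      nlinarith⟩
  rw [show order k - u = i by omega]
  rw [order] at hi
  refine le_card_column (lo := lo) fun j hj hj' => ⟨by omega, ?_, ?_⟩ <;>
    zify at * <;> nlinarith

theorem card_column_order_pos (k : ℕ) : 0 < (column k (order k)).card :=
  le_card_column (lo := (k + 1) * (4 * k + 7)) fun j hj hj' => by
    obtain rfl : j = (k + 1) * (4 * k + 7) := by omega
    refine ⟨le_rfl, ?_, ?_⟩ <;> rw [order] <;> nlinarith

theorem lt_card_columns (k : ℕ) : order k * (order k + 1) <
    2 * ∑ i ∈ Finset.range (order k + 1), (column k i).card := by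
  have hk : order k + 1 = (4 * k + 3) * (k + 1) + 2 * (k + 1) := by rw [order]; ring
  have gauss : ∀ n : ℕ, 2 * ∑ s ∈ Finset.range (n + 1), s = n * (n + 1) := fun n => by
    rw [mul_comm, Finset.sum_range_id_mul_two]; simp [mul_comm]
  have left : ∑ s ∈ Finset.range (k + 1), ((4 * k + 3) * (4 * k + 5) * s + 8 * (k + 1) ^ 2) ≤
      ∑ i ∈ Finset.range ((4 * k + 3) * (k + 1)), (column k i).card := by
    refine le_sum_range_mul fun s hs => ?_
    refine le_trans (le_of_eq ?_) (Finset.sum_le_sum fun r hr =>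
      le_card_column_left (by omega : s ≤ k) (Finset.mem_range.1 hr))
    rw [Finset.sum_add_distrib, Finset.sum_add_distrib, Finset.sum_add_distrib]
    have h1 : ∑ r ∈ Finset.range (4 * k + 3), (if 2 * k + 1 ≤ r then 1 else 0) = 2 * k + 2 := by
      rw [show 4 * k + 3 = (2 * k + 1) + (2 * k + 2) by ring, Finset.sum_range_add,
        Finset.sum_eq_zero fun r hr => if_neg (by simpa using hr)]
      simp
    have h2 := gauss (4 * k + 2)
    rw [h1]
    simp
    nlinarith
  have right : ∑ w ∈ Finset.range (k + 1),
      ((4 * k + 5) * 2 * w + (2 * k + 2) + if w = 0 then 1 else 0) ≤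
      ∑ u ∈ Finset.range (2 * (k + 1)), (column k (order k - u)).card := by
    refine le_sum_range_mul fun w hw => ?_
    have h1 := le_card_column_right (k := k) (u := 2 * w + 1) (n := (4 * k + 5) * w + (2 * k + 2))
      (by omega) (by omega) (by nlinarith)
    rw [Finset.sum_range_succ, Finset.sum_range_one]
    rcases Nat.eq_zero_or_pos w with rfl | hw0
    · have h2 := card_column_order_pos k
      simp only [mul_zero, zero_add, if_true, Nat.sub_zero] at h1 ⊢
      omega
    · have h2 := le_card_column_right (k := k) (u := 2 * w) (n := (4 * k + 5) * w)
        (by omega) (by omega) (by nlinarith)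
      rw [if_neg hw0.ne', add_zero, add_zero]
      linarith
  have reflect : ∑ u ∈ Finset.range (2 * (k + 1)), (column k (order k - u)).card =
      ∑ v ∈ Finset.range (2 * (k + 1)), (column k ((4 * k + 3) * (k + 1) + v)).card := by
    rw [← Finset.sum_range_reflect]
    refine Finset.sum_congr rfl fun v hv => ?_
    rw [Finset.mem_range] at hv
    congr 2
    omega
  have h1 := gauss k
  rw [hk, Finset.sum_range_add, ← reflect]
  rw [Finset.sum_add_distrib, ← Finset.mul_sum] at left
  rw [Finset.sum_add_distrib, Finset.sum_add_distrib, ← Finset.mul_sum] at right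
  simp only [Finset.sum_const, Finset.card_range, smul_eq_mul, Finset.sum_ite_eq',
    Finset.mem_range, Nat.zero_lt_succ, if_true] at left right
  generalize ∑ i ∈ Finset.range ((4 * k + 3) * (k + 1)), (column k i).card = A at left ⊢
  generalize ∑ u ∈ Finset.range (2 * (k + 1)), (column k (order k - u)).card = B at right ⊢
  generalize ∑ s ∈ Finset.range (k + 1), s = G at left right h1
  clear gauss reflect hk
  rw [order]
  zify at *
  nlinarith

theorem exists_irreducible (k : ℕ) : ∃ f : MvPolynomial (Fin 2) ℂ, Irreducible f ∧
    (∀ e ∈ f.support, InTriangle k (e 0) (e 1)) ∧ VanishesToOrder (order k) f := by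
  classical
  let s : Finset (Fin 2 →₀ ℕ) :=
    ((Finset.range (order k + 1)).sigma (column k)).image fun p => expo p.1 p.2
  have hs : s.card = ∑ i ∈ Finset.range (order k + 1), (column k i).card := by
    rw [Finset.card_image_of_injective, Finset.card_sigma]
    rintro ⟨i, j⟩ ⟨i', j'⟩ h
    obtain ⟨h0, h1⟩ := expo_eq_iff.1 h
    simpa using And.intro h0 h1
  obtain ⟨f, hf, hfs, hord⟩ := exists_vanishesToOrder (hs ▸ lt_card_columns k)
  have hsupp : ∀ e ∈ f.support, InTriangle k (e 0) (e 1) := fun e he => by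
    obtain ⟨p, hp, rfl⟩ := Finset.mem_image.1 (hfs he)
    rw [expo_zero, expo_one]
    exact (Finset.mem_filter.1 (Finset.mem_sigma.1 hp).2).2
  exact ⟨f, irreducible_of_vanishesToOrder hf hsupp hord, hsupp, hord⟩

theorem InTriangle.mem_convexHull {k i j : ℕ} (h : InTriangle k i j) :
    ((i : ℝ), (j : ℝ)) ∈ convexHull ℝ
      ({(-1 / (4 * k + 5 : ℝ), 0), ((4 * k ^ 2 + 7 * k + 2 : ℝ), 0),
        ((order k : ℝ), (k + 1 : ℝ) * (4 * k + 7))} : Set (ℝ × ℝ)) := by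
  obtain ⟨h1, h2⟩ := h
  rw [← @Nat.cast_le ℝ] at h1 h2
  push_cast at h1 h2
  have hD : (0 : ℝ) < (k + 1) * (16 * k ^ 2 + 32 * k + 11) := by positivity
  have hH : (0 : ℝ) < (k + 1) * (4 * k + 7) := by positivity
  have hE : (0 : ℝ) < (4 * k + 7) * ((k + 1) * (16 * k ^ 2 + 32 * k + 11)) := by positivity
  have ha : (0 : ℝ) < 4 * k + 5 := by positivity
  have hw := (convex_convexHull ℝ
      ({(-1 / (4 * k + 5 : ℝ), 0), ((4 * k ^ 2 + 7 * k + 2 : ℝ), 0),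
        ((order k : ℝ), (k + 1 : ℝ) * (4 * k + 7))} : Set (ℝ × ℝ))).sum_mem
    (t := Finset.univ)
    (w := (![(4 * k + 5) * (2 * j + (4 * k + 7) * (4 * k ^ 2 + 7 * k + 2) - (4 * k + 7) * i) /
        ((4 * k + 7) * ((k + 1) * (16 * k ^ 2 + 32 * k + 11))),
      ((4 * k + 5) * i + 1 - (4 * k + 3) * j) / ((k + 1) * (16 * k ^ 2 + 32 * k + 11)),
      j / ((k + 1) * (4 * k + 7))] : Fin 3 → ℝ))
    (z := ![(-1 / (4 * k + 5 : ℝ), 0), ((4 * k ^ 2 + 7 * k + 2 : ℝ), 0),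
      ((order k : ℝ), (k + 1 : ℝ) * (4 * k + 7))]) ?_ ?_ ?_
  · convert hw using 1
    simp only [Fin.sum_univ_three, order]
    ext
    · simp
      field_simp
      ring
    · simp
      field_simp
  · intro i _
    fin_cases i
    · exact div_nonneg (mul_nonneg ha.le (by linarith)) hE.le
    · exact div_nonneg (by linarith) hD.le
    · exact div_nonneg (by positivity) hH.le
  · simp only [Fin.sum_univ_three]
    simp
    field_simp
    ring
  · intro i _
    refine subset_convexHull ℝ _ ?_
    fin_cases i <;> simp

end

theorem stmt8 (K : ℤ) (hK : 4 ≤ K) (hKeven : Even K)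
    (a b : ℤ) (m : ℕ) (ha : a = 2 * K - 3) (hb : b = 2 * K - 1)
    (hm : 2 * (m : ℤ) = 2 * K ^ 2 - 7 * K + 4) :
    ∃ f : MvPolynomial (Fin 2) ℂ, f ≠ 0 ∧ Irreducible f ∧
      (∀ e ∈ f.support,
        ((e 0 : ℝ), (e 1 : ℝ)) ∈ convexHull ℝ
          ({(-1 / (a : ℝ), 0), ((m : ℝ) - (K : ℝ) + 2, 0),
            ((m : ℝ), ((K : ℝ) - 2) * (b : ℝ) / 2)} : Set (ℝ × ℝ))) ∧
      f ∈ (Ideal.span {X 0 - 1, X 1 - 1} : Ideal (MvPolynomial (Fin 2) ℂ)) ^ m := by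
  obtain ⟨c, rfl⟩ := hKeven
  obtain ⟨k, rfl⟩ : ∃ k : ℕ, c = k + 2 := ⟨(c - 2).toNat, by omega⟩
  obtain rfl : m = order k := by
    rw [order]
    zify
    linarith
  obtain ⟨f, hf, hsupp, hord⟩ := exists_irreducible k
  refine ⟨f, hf.ne_zero, hf, fun e he => ?_, hord.mem_pow⟩
  convert (hsupp e he).mem_convexHull using 6
  · rw [ha]; push_cast; ring
  · rw [order]; push_cast; ring
  · rw [hb]; push_cast; ring
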